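/- arXiv:2305.08203 — 2 statements merged into one kernel-verified Lean document; each statement's English description precedes it below -/
import Mathlib

section
/- Let γ > 4, ψ(x) = x^{-1/(γ-1)} for x ∈ (0,1], B = ∫₀¹ ψ(x) dx, g(x) = ∫₀¹ ψ(b)(1 − exp(−x ψ(b))) db, θ_c = 1/∫₀¹ ψ(x)² dx = (γ−3)/(γ−1), and for θ > θ_c let A_θ denote the unique positive solution of A = θ g(A). Define ρ̄(θ) = ∫₀¹ (1 − exp(−A_θ ψ(x))) dx. Then as θ ↓ θ_c, ρ̄(θ) ∼ C_γ (θ − θ_c) with the explicit constant C_γ = B · (2 ∫₀¹ ψ(x)² dx) / (θ_c ∫₀¹ ψ(x)³ dx); that is, ρ̄(θ)/(C_γ (θ − θ_c)) → 1 as θ ↓ θ_c. -/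
open MeasureTheory Filter Set

/-- The remainder `u - (1 - exp (-u))` is at most `u ^ 2` for nonnegative `u`. -/
lemma sub_one_sub_exp_neg_le_sq {u : ℝ} (hu : 0 ≤ u) : u - (1 - Real.exp (-u)) ≤ u ^ 2 := by
  rcases le_total u 1 with h | h
  · have := (abs_le.mp (Real.abs_exp_sub_one_sub_id_le (x := -u)
      (by rwa [abs_neg, abs_of_nonneg hu]))).2
    nlinarith
  · have : Real.exp (-u) ≤ 1 := Real.exp_le_one_iff.mpr (by linarith)
    nlinarith

lemma one_sub_exp_neg_le (u : ℝ) : 1 - Real.exp (-u) ≤ u := by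
  linarith [Real.add_one_le_exp (-u)]

/-- A lower bound for `u - (1 - exp (-u))`: quadratic near zero and linear at infinity. -/
lemma mul_min_le_sub_one_sub_exp_neg {u : ℝ} (hu : 0 ≤ u) :
    u * min (u / 4) (1 / 2) ≤ u - (1 - Real.exp (-u)) := by
  rcases le_total u 2 with h | h
  · have h1 : 1 - u / 2 ≤ Real.exp (-(u / 2)) := by linarith [Real.add_one_le_exp (-(u / 2))]
    have h2 : Real.exp (-u) = Real.exp (-(u / 2)) * Real.exp (-(u / 2)) := by
      rw [← Real.exp_add]; ring_nf
    have h3 : (1 - u / 2) * (1 - u / 2) ≤ Real.exp (-(u / 2)) * Real.exp (-(u / 2)) :=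
      mul_self_le_mul_self (by linarith) h1
    have h4 : u * min (u / 4) (1 / 2) ≤ u * (u / 4) :=
      mul_le_mul_of_nonneg_left (min_le_left _ _) hu
    nlinarith
  · have h4 : u * min (u / 4) (1 / 2) ≤ u * (1 / 2) :=
      mul_le_mul_of_nonneg_left (min_le_right _ _) hu
    linarith [Real.exp_pos (-u)]

lemma tendsto_one_sub_exp_neg_mul_div (c : ℝ) :
    Tendsto (fun t : ℝ => (1 - Real.exp (-t * c)) / t) (nhdsWithin 0 (Ioi 0)) (nhds c) := by
  have hd : HasDerivAt (fun t : ℝ => 1 - Real.exp (-t * c)) c 0 := by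
    have h := (((hasDerivAt_id (0 : ℝ)).neg.mul_const c).exp).const_sub 1
    simpa using h
  have h := hd.tendsto_slope_zero_right
  refine h.congr fun t => ?_
  simp [div_eq_inv_mul]

lemma tendsto_mul_sub_one_sub_exp_neg_mul_div_sq (c : ℝ) :
    Tendsto (fun t : ℝ => (t * c - (1 - Real.exp (-t * c))) / t ^ 2)
      (nhdsWithin 0 (Ioi 0)) (nhds (c ^ 2 / 2)) := by
  have hsmall : ∀ᶠ t : ℝ in nhdsWithin 0 (Ioi 0), |(-t * c)| ≤ 1 := by
    have h : Tendsto (fun t : ℝ => |(-t * c)|) (nhds 0) (nhds 0) := by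
      have : Continuous (fun t : ℝ => |(-t * c)|) := by fun_prop
      simpa using this.tendsto 0
    exact ((h.mono_left nhdsWithin_le_nhds).eventually_lt_const one_pos).mono fun _ h => h.le
  rw [tendsto_iff_norm_sub_tendsto_zero]
  have hlim : Tendsto (fun t : ℝ => |t| * |c| ^ 3) (nhdsWithin 0 (Ioi 0)) (nhds 0) := by
    have : Continuous (fun t : ℝ => |t| * |c| ^ 3) := by fun_prop
    simpa using (this.tendsto 0).mono_left nhdsWithin_le_nhds
  refine squeeze_zero' (Eventually.of_forall fun _ => norm_nonneg _) ?_ hlim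
  filter_upwards [hsmall, self_mem_nhdsWithin] with t ht ht0
  have ht0' : (0 : ℝ) < t := ht0
  have hb := Real.exp_bound ht (n := 3) (by norm_num)
  have heq : (t * c - (1 - Real.exp (-t * c))) / t ^ 2 - c ^ 2 / 2
      = (Real.exp (-t * c) - ∑ m ∈ Finset.range 3, (-t * c) ^ m / (m.factorial : ℝ)) / t ^ 2 := by
    simp [Finset.sum_range_succ, Nat.factorial]
    field_simp
    ring
  rw [heq, Real.norm_eq_abs, abs_div, abs_of_pos (pow_pos ht0' 2), div_le_iff₀ (pow_pos ht0' 2)]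
  refine hb.trans ?_
  rw [abs_mul, abs_neg, mul_pow, abs_of_pos ht0']
  have hc : 0 ≤ t ^ 3 * |c| ^ 3 := by positivity
  norm_num [Nat.factorial]
  nlinarith

section LaplaceAsymptotics

variable {α : Type*} [MeasurableSpace α] {μ : Measure α} {ψ : α → ℝ}

lemma tendsto_integral_one_sub_exp_neg_mul_div (hψ : Integrable ψ μ) (h0 : ∀ᵐ x ∂μ, 0 ≤ ψ x) :
    Tendsto (fun t : ℝ => (∫ x, (1 - Real.exp (-t * ψ x)) ∂μ) / t)
      (nhdsWithin 0 (Ioi 0)) (nhds (∫ x, ψ x ∂μ)) := by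
  simp_rw [← integral_div]
  refine tendsto_integral_filter_of_dominated_convergence ψ ?_ ?_ hψ
    (Eventually.of_forall fun x => tendsto_one_sub_exp_neg_mul_div (ψ x))
  · refine Eventually.of_forall fun t => ?_
    have hm := hψ.aestronglyMeasurable.aemeasurable
    exact AEMeasurable.aestronglyMeasurable (by fun_prop)
  · filter_upwards [self_mem_nhdsWithin] with t (ht : 0 < t)
    filter_upwards [h0] with x hx
    have h1 : Real.exp (-t * ψ x) ≤ 1 := Real.exp_le_one_iff.mpr (by nlinarith)
    rw [Real.norm_of_nonneg (div_nonneg (by linarith) ht.le), div_le_iff₀ ht, neg_mul]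
    linarith [one_sub_exp_neg_le (t * ψ x)]

lemma tendsto_integral_mul_sub_one_sub_exp_neg_mul_div_sq (hm : AEMeasurable ψ μ)
    (hψ : Integrable (fun x => ψ x ^ 3) μ) (h0 : ∀ᵐ x ∂μ, 0 ≤ ψ x) :
    Tendsto (fun t : ℝ => (∫ x, ψ x * (t * ψ x - (1 - Real.exp (-t * ψ x))) ∂μ) / t ^ 2)
      (nhdsWithin 0 (Ioi 0)) (nhds ((∫ x, ψ x ^ 3 ∂μ) / 2)) := by
  simp_rw [← integral_div]
  refine tendsto_integral_filter_of_dominated_convergence (fun x => ψ x ^ 3) ?_ ?_ hψ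
    (Eventually.of_forall fun x => ?_)
  · exact Eventually.of_forall fun t => AEMeasurable.aestronglyMeasurable (by fun_prop)
  · filter_upwards [self_mem_nhdsWithin] with t (ht : 0 < t)
    filter_upwards [h0] with x hx
    rw [neg_mul]
    have hu : 0 ≤ t * ψ x := mul_nonneg ht.le hx
    have h1 := sub_nonneg.mpr (one_sub_exp_neg_le (t * ψ x))
    rw [Real.norm_of_nonneg (div_nonneg (mul_nonneg hx h1) (by positivity)),
      div_le_iff₀ (by positivity)]
    calc _ ≤ ψ x * (t * ψ x) ^ 2 :=
          mul_le_mul_of_nonneg_left (sub_one_sub_exp_neg_le_sq hu) hx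
      _ = ψ x ^ 3 * t ^ 2 := by ring
  · convert (tendsto_mul_sub_one_sub_exp_neg_mul_div_sq (ψ x)).const_mul (ψ x) using 2
    · ring
    · ring

end LaplaceAsymptotics

/-- For `γ > 4`, `ψ(x) = x^(-1/(γ-1))`, `B = ∫₀¹ ψ`,
`g(x) = ∫₀¹ ψ(b)(1 - exp(-x ψ(b))) db`, `θ_c = 1/∫₀¹ ψ² = (γ-3)/(γ-1)`, `A θ` the
unique positive solution of `A = θ g(A)` for `θ > θ_c`, and
`ρ̄(θ) = ∫₀¹ (1 - exp(-A_θ ψ(x))) dx`:  as `θ ↓ θ_c`,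
`ρ̄(θ) ∼ C_γ (θ - θ_c)` with `C_γ = B · (2∫₀¹ψ²)/(θ_c ∫₀¹ψ³)`. -/
theorem chungLu_giant_component_supercritical (γ : ℝ) (hγ : 4 < γ)
    (ψ g A ρbar : ℝ → ℝ) (B θc Cγ : ℝ)
    (hψ : ∀ x, ψ x = x ^ (-(1 / (γ - 1))))
    (hB : B = ∫ x in (0:ℝ)..1, ψ x)
    (hg : ∀ x, g x = ∫ b in (0:ℝ)..1, ψ b * (1 - Real.exp (-x * ψ b)))
    (hθc : θc = 1 / ∫ x in (0:ℝ)..1, (ψ x) ^ 2)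
    (hθc' : θc = (γ - 3) / (γ - 1))
    (hA : ∀ θ : ℝ, θc < θ →
      0 < A θ ∧ A θ = θ * g (A θ) ∧
        ∀ A' : ℝ, 0 < A' → A' = θ * g A' → A' = A θ)
    (hρ : ∀ θ, ρbar θ = ∫ x in (0:ℝ)..1, (1 - Real.exp (-(A θ) * ψ x)))
    (hC : Cγ = B * (2 * ∫ x in (0:ℝ)..1, (ψ x) ^ 2) /
        (θc * ∫ x in (0:ℝ)..1, (ψ x) ^ 3)) :
    Tendsto (fun θ => ρbar θ / (Cγ * (θ - θc)))
      (nhdsWithin θc (Ioi θc)) (nhds 1) := by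
  have hγ1 : 0 < γ - 1 := by linarith
  set μ : Measure ℝ := volume.restrict (Ioc 0 1) with hμ
  simp only [intervalIntegral.integral_of_le zero_le_one] at hB hg hθc hρ hC
  rw [← hμ] at hB hθc hC
  simp only [← hμ] at hg hρ
  have h1 : ∀ᵐ x ∂μ, 1 ≤ ψ x := by
    filter_upwards [ae_restrict_mem measurableSet_Ioc] with x hx
    rw [hψ]
    exact Real.one_le_rpow_of_pos_of_le_one_of_nonpos hx.1 hx.2
      (neg_nonpos.mpr (one_div_nonneg.mpr hγ1.le))
  have h0 : ∀ᵐ x ∂μ, 0 ≤ ψ x := h1.mono fun x hx => zero_le_one.trans hx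
  have hmeas : Measurable ψ := by
    rw [funext hψ]
    fun_prop
  have hint : ∀ k : ℕ, k ≤ 3 → Integrable (fun x => ψ x ^ k) μ := by
    intro k hk
    have hk' : (k : ℝ) ≤ 3 := by exact_mod_cast hk
    have hr : -1 < -(1 / (γ - 1)) * k := by
      have : (k : ℝ) / (γ - 1) < 1 := by rw [div_lt_one hγ1]; linarith
      have h2 : -(1 / (γ - 1)) * k = -(k / (γ - 1)) := by ring
      linarith
    have h := intervalIntegral.intervalIntegrable_rpow' (a := 0) (b := 1) hr
    rw [intervalIntegrable_iff_integrableOn_Ioc_of_le zero_le_one] at h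
    refine Integrable.congr h ?_
    filter_upwards [ae_restrict_mem measurableSet_Ioc] with x hx
    rw [hψ, Real.rpow_mul_natCast hx.1.le]
  have hi1 : Integrable ψ μ := by simpa using hint 1 (by norm_num)
  have hi2 := hint 2 (by norm_num)
  have hi3 := hint 3 le_rfl
  have hprob : IsProbabilityMeasure μ := ⟨by simp [hμ]⟩
  have hpos : ∀ k : ℕ, k ≤ 3 → 1 ≤ ∫ x, ψ x ^ k ∂μ := by
    intro k hk
    have h := integral_mono_ae (integrable_const (1 : ℝ)) (hint k hk)
      (h1.mono fun x hx => one_le_pow₀ hx)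
    simpa using h
  have hBpos : 1 ≤ B := by rw [hB]; simpa using hpos 1 (by norm_num)
  have hm2 := hpos 2 (by norm_num)
  have hm3 := hpos 3 le_rfl
  set m2 := ∫ x, ψ x ^ 2 ∂μ with hm2def
  set m3 := ∫ x, ψ x ^ 3 ∂μ with hm3def
  have hθpos : 0 < θc := by rw [hθc]; positivity
  have hm2θ : m2 = 1 / θc := by rw [hθc]; simp
  -- the second-order remainder of `g` at zero
  set R : ℝ → ℝ := fun t => ∫ x, ψ x * (t * ψ x - (1 - Real.exp (-t * ψ x))) ∂μ with hR
  have hgint : ∀ t, 0 < t → Integrable (fun x => ψ x * (1 - Real.exp (-t * ψ x))) μ := by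
    intro t ht
    refine hi1.mono' (Measurable.aestronglyMeasurable (by fun_prop)) ?_
    filter_upwards [h0] with x hx
    have h2 : Real.exp (-t * ψ x) ≤ 1 := Real.exp_le_one_iff.mpr (by nlinarith)
    rw [Real.norm_of_nonneg (mul_nonneg hx (by linarith))]
    exact mul_le_of_le_one_right hx (by linarith [Real.exp_pos (-t * ψ x)])
  have hRint : ∀ t, 0 < t →
      Integrable (fun x => ψ x * (t * ψ x - (1 - Real.exp (-t * ψ x)))) μ := by
    intro t ht
    refine ((hi2.const_mul t).sub (hgint t ht)).congr (Eventually.of_forall fun x => ?_)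
    simp only [Pi.sub_apply]
    ring
  have hRg : ∀ t, 0 < t → R t = t * m2 - g t := by
    intro t ht
    rw [hg, hm2def, ← integral_const_mul, ← integral_sub (hi2.const_mul t) (hgint t ht)]
    refine integral_congr_ae (Eventually.of_forall fun x => ?_)
    ring
  have hRlow : ∀ t, 0 < t → t * min (t / 4) (1 / 2) ≤ R t := by
    intro t ht
    have h := integral_mono_ae (integrable_const (t * min (t / 4) (1 / 2))) (hRint t ht) ?_
    · simpa [hR] using h
    filter_upwards [h1] with x hx
    have hu : t ≤ t * ψ x := le_mul_of_one_le_right ht.le hx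
    have h2 := mul_min_le_sub_one_sub_exp_neg (ht.le.trans hu)
    have h3 : t * min (t / 4) (1 / 2) ≤ t * ψ x * min (t * ψ x / 4) (1 / 2) := by
      gcongr
    rw [neg_mul]
    have h4 := sub_nonneg.mpr (one_sub_exp_neg_le (t * ψ x))
    exact (h3.trans h2).trans (le_mul_of_one_le_left h4 hx)
  have hRA : ∀ θ, θc < θ → R (A θ) = A θ * ((θ - θc) / (θ * θc)) := by
    intro θ hθ
    obtain ⟨hA0, hA1, -⟩ := hA θ hθ
    have hθ0 : 0 < θ := hθpos.trans hθ
    have hgA : g (A θ) = A θ / θ := by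
      rw [eq_div_iff hθ0.ne', mul_comm]
      exact hA1.symm
    rw [hRg _ hA0, hgA, hm2θ]
    field_simp
  have hs : Tendsto (fun θ => (θ - θc) / (θ * θc)) (nhdsWithin θc (Ioi θc)) (nhds 0) := by
    have h : ContinuousAt (fun θ => (θ - θc) / (θ * θc)) θc := by
      have : θc * θc ≠ 0 := by positivity
      fun_prop (disch := assumption)
    have h2 := h.tendsto.mono_left (nhdsWithin_le_nhds (s := Ioi θc))
    simpa using h2
  have hAlim : Tendsto A (nhdsWithin θc (Ioi θc)) (nhdsWithin 0 (Ioi 0)) := by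
    refine tendsto_nhdsWithin_iff.mpr ⟨?_, ?_⟩
    · refine squeeze_zero' (g := fun θ => 4 * ((θ - θc) / (θ * θc))) ?_ ?_
        (by simpa using hs.const_mul 4)
      · filter_upwards [self_mem_nhdsWithin] with θ hθ using (hA θ hθ).1.le
      · filter_upwards [self_mem_nhdsWithin, hs.eventually_lt_const (u := 1 / 2) (by norm_num)]
          with θ hθ hlt
        have hA0 := (hA θ hθ).1
        have h := hRlow _ hA0
        rw [hRA θ hθ] at h
        rcases min_le_iff.mp (le_of_mul_le_mul_left h hA0) with h | h <;> linarith
    · filter_upwards [self_mem_nhdsWithin] with θ hθ using (hA θ hθ).1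
  have hF := (tendsto_integral_one_sub_exp_neg_mul_div hi1 h0).comp hAlim
  have hH := (tendsto_integral_mul_sub_one_sub_exp_neg_mul_div_sq hmeas.aemeasurable hi3 h0).comp
    hAlim
  rw [← hB] at hF
  have hid : Tendsto (fun θ : ℝ => θ) (nhdsWithin θc (Ioi θc)) (nhds θc) :=
    tendsto_id.mono_left nhdsWithin_le_nhds
  have hCpos : 0 < Cγ := by rw [hC]; positivity
  have hlim := hF.div ((hH.const_mul Cγ).mul (hid.mul_const θc)) (by positivity)
  have hone : B / (Cγ * (m3 / 2) * (θc * θc)) = 1 := by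
    rw [hC, hm2θ]
    field_simp
  rw [← hm3def, hone] at hlim
  refine hlim.congr' ?_
  filter_upwards [self_mem_nhdsWithin] with θ hθ
  have hA0 := (hA θ hθ).1
  have hd : 0 < θ - θc := sub_pos.mpr hθ
  have hθ0 : 0 < θ := hθpos.trans hθ
  have hRθ := hRA θ hθ
  simp only [hR] at hRθ
  simp only [Pi.div_apply, Function.comp_apply]
  rw [hRθ, ← hρ]
  field_simp
end

section
/- Let γ > 3, 0 < θ < θ_c = (γ−3)/(γ−1), and ψ(x) = x^{-1/(γ-1)}. For each n, let G_n be the random graph on vertex set {1, …, n} in which, independently for each pair i < j, the edge {i, j} is present with probability min(1, θ ψ(i/n) ψ(j/n)/n). Then there exists a constant C, depending only on γ and θ, such that P( max_v |𝒞_v| ≥ C n^{1/(γ−1)} ) → 0 as n → ∞, where 𝒞_v denotes the connected component of vertex v in G_n. -/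
open MeasureTheory ProbabilityTheory Filter Set

/-- The vertices reachable from `A` by walks of `G` whose later vertices all lie in `W`. -/
def SimpleGraph.clusterWithin {V : Type*} (G : SimpleGraph V) (W A : Finset V) : Set V :=
  {v | ∃ a ∈ A, Relation.ReflTransGen (fun x y => G.Adj x y ∧ y ∈ W) a v}

theorem SimpleGraph.clusterWithin_subset_insert {V : Type*} [DecidableEq V] (G : SimpleGraph V)
    (W A N : Finset V) (i : V) (hN : ∀ j ∈ W, j ∉ A → G.Adj i j → j ∈ N) :
    G.clusterWithin W A ⊆ insert i (G.clusterWithin (W.erase i) (A.erase i ∪ N)) := by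
  rintro v ⟨a, ha, hav⟩
  induction hav with
  | refl =>
    by_cases h : a = i
    · exact Or.inl h
    · exact Or.inr ⟨a, by simp [h, ha], .refl⟩
  | @tail x y _ hxy ih =>
    by_cases hy : y = i
    · exact Or.inl hy
    right
    rcases ih with rfl | ⟨c, hc, hcx⟩
    · refine ⟨y, ?_, .refl⟩
      by_cases hyA : y ∈ A
      · simp [hy, hyA]
      · simp [hN y hxy.2 hyA hxy.1]
    · exact ⟨c, hc, hcx.tail ⟨hxy.1, by simp [hy, hxy.2]⟩⟩

theorem SimpleGraph.supp_connectedComponentMk_eq_clusterWithin {V : Type*} [Fintype V]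
    (G : SimpleGraph V) (v : V) :
    (G.connectedComponentMk v).supp = G.clusterWithin Finset.univ {v} := by
  ext u
  simp only [ConnectedComponent.mem_supp_iff, ConnectedComponent.eq, clusterWithin,
    Finset.mem_singleton, Finset.mem_univ, and_true, exists_eq_left, mem_ofPred_eq]
  rw [SimpleGraph.reachable_comm, SimpleGraph.reachable_iff_reflTransGen]

/-- Expanding a product of independent two-valued weights over the set of events that occur. -/
theorem ProbabilityTheory.iIndepSet.sum_powerset_measure_mul_prod {V Ω : Type*} [DecidableEq V]
    [MeasurableSpace Ω] {μ : Measure Ω} {B : V → Set Ω} (hB : iIndepSet B μ)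
    (U : Finset V) (φ : V → ENNReal) :
    ∑ N ∈ U.powerset, μ (⋂ j ∈ U, if j ∈ N then B j else (B j)ᶜ) * ∏ j ∈ N, φ j
      = ∏ j ∈ U, (μ (B j) * φ j + μ (B j)ᶜ) := by
  rw [Finset.prod_add]
  refine Finset.sum_congr rfl fun N hN => ?_
  have hNU := Finset.mem_powerset.1 hN
  have hgen : ∀ j, MeasurableSet[MeasurableSpace.generateFrom {B j}] (B j) := fun j =>
    MeasurableSpace.measurableSet_generateFrom rfl
  rw [iIndep.meas_biInter (S := U) hB, ← Finset.prod_sdiff hNU, Finset.prod_mul_distrib,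
    mul_comm (∏ j ∈ U \ N, _), mul_right_comm]
  · congr 1
    · congr 1
      exact Finset.prod_congr rfl fun j hj => by simp [hj]
    · exact Finset.prod_congr rfl fun j hj => by simp [(Finset.mem_sdiff.1 hj).2]
  · intro j _
    split_ifs
    · exact hgen j
    · exact (hgen j).compl

/-- Exponential moments of clusters of a random graph with independent edges are bounded by any
supersolution `φ` of the branching recursion. The dominating function is measurable with respect
to the edges inside `W`. -/
theorem exists_clusterWithin_pow_le {V Ω : Type*} [Fintype V] [DecidableEq V]
    [MeasurableSpace Ω] (μ : Measure Ω) [IsProbabilityMeasure μ] (G : Ω → SimpleGraph V)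
    (hmeas : ∀ p : Sym2 V, MeasurableSet {ω | p ∈ (G ω).edgeSet})
    (hindep : iIndepSet (fun p : Sym2 V => {ω | p ∈ (G ω).edgeSet}) μ)
    (e : ENNReal) (he : 1 ≤ e) (φ : V → ENNReal)
    (hφ : ∀ (i : V) (U : Finset V), i ∉ U →
      e * ∏ j ∈ U, (μ {ω | (G ω).Adj i j} * φ j + μ {ω | (G ω).Adj i j}ᶜ) ≤ φ i)
    (W A : Finset V) (hAW : A ⊆ W) :
    ∃ f : Ω → ENNReal,
      Measurable[⨆ p ∈ (W.sym2 : Set (Sym2 V)),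
        MeasurableSpace.generateFrom {{ω | p ∈ (G ω).edgeSet}}] f ∧
      (∀ ω, e ^ ((G ω).clusterWithin W A).ncard ≤ f ω) ∧
      ∫⁻ ω, f ω ∂μ ≤ ∏ j ∈ A, φ j := by
  induction W using Finset.strongInduction generalizing A with
  | H W ih =>
  rcases A.eq_empty_or_nonempty with rfl | ⟨i, hi⟩
  · exact ⟨fun _ => 1, measurable_const, fun ω => by simp [SimpleGraph.clusterWithin], by simp⟩
  set m : Sym2 V → MeasurableSpace Ω := fun p =>
    MeasurableSpace.generateFrom {{ω | p ∈ (G ω).edgeSet}} with hm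
  have hm_le : ∀ p, m p ≤ ‹MeasurableSpace Ω› := fun p =>
    MeasurableSpace.generateFrom_le (by rintro _ rfl; exact hmeas p)
  set U := W \ A with hU
  have hiW : i ∈ W := hAW hi
  have hiU : i ∉ U := by simp [hU, hi]
  have hsub : ∀ N ∈ U.powerset, A.erase i ∪ N ⊆ W.erase i := by
    intro N hN j hj
    have := Finset.mem_powerset.1 hN
    grind
  choose! f hf_meas hf_le hf_int using fun N (hN : N ∈ U.powerset) =>
    ih (W.erase i) (Finset.erase_ssubset hiW) (A.erase i ∪ N) (hsub N hN)
  set B : V → Set Ω := fun j => {ω | (G ω).Adj i j} with hB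
  set D : Finset V → Set Ω := fun N => ⋂ j ∈ U, if j ∈ N then B j else (B j)ᶜ with hD
  have hBindep : iIndepSet B μ :=
    iIndep.precomp (g := fun j => s(i, j)) (fun a b h => Sym2.congr_right.1 h) hindep
  have hBm : ∀ j, MeasurableSet[m s(i, j)] (B j) := fun j =>
    MeasurableSpace.measurableSet_generateFrom rfl
  set T : Set (Sym2 V) := Set.image (fun j => s(i, j)) U with hT
  have hDm : ∀ N, MeasurableSet[⨆ p ∈ T, m p] (D N) := by
    intro N
    refine Finset.measurableSet_biInter _ fun j hj => ?_
    have hle : m s(i, j) ≤ ⨆ p ∈ T, m p := le_iSup₂_of_le s(i, j) ⟨j, hj, rfl⟩ le_rfl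
    split_ifs
    · exact hle _ (hBm j)
    · exact (hle _ (hBm j)).compl
  have hTle : ∀ S : Set (Sym2 V), ⨆ p ∈ S, m p ≤ ‹MeasurableSpace Ω› := fun S =>
    iSup₂_le fun p _ => hm_le p
  have hind_meas : ∀ {m' : MeasurableSpace Ω}, ⨆ p ∈ T, m p ≤ m' → ∀ N,
      Measurable[m'] ((D N).indicator (1 : Ω → ENNReal)) := fun h N =>
    Measurable.indicator (@measurable_one _ _ _ _ _) (h _ (hDm N))
  have hTW : T ⊆ (W.sym2 : Set (Sym2 V)) := by
    rintro _ ⟨j, hj, rfl⟩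
    have : j ∈ W := (Finset.mem_sdiff.1 hj).1
    simp [hiW, this]
  have hdisj : Disjoint T ((W.erase i).sym2 : Set (Sym2 V)) := by
    rw [Set.disjoint_left]
    rintro _ ⟨j, hj, rfl⟩
    simp
  have hind := indep_iSup_of_disjoint hm_le hindep hdisj
  have hsym : ((W.erase i).sym2 : Set (Sym2 V)) ⊆ (W.sym2 : Set (Sym2 V)) := by
    exact_mod_cast Finset.sym2_mono (Finset.erase_subset i W)
  refine ⟨fun ω => ∑ N ∈ U.powerset, (D N).indicator 1 ω * (e * f N ω), ?_, ?_, ?_⟩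
  · refine Finset.measurable_sum _ fun N hN => ?_
    refine Measurable.mul ?_ (Measurable.const_mul ?_ _)
    · exact hind_meas (biSup_mono (f := m) fun p hp => hTW hp) N
    · exact (hf_meas N hN).mono (biSup_mono fun p hp => hsym hp) le_rfl
  · intro ω
    classical
    set N := U.filter fun j => (G ω).Adj i j with hN
    have hNU : N ∈ U.powerset := Finset.mem_powerset.2 (Finset.filter_subset _ _)
    refine le_trans ?_ (Finset.single_le_sum (fun _ _ => zero_le) hNU)
    have hω : ω ∈ D N := by
      simp only [hD, mem_iInter]
      intro j hj
      by_cases h : (G ω).Adj i j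
      · simp [hN, hj, h, hB]
      · simp [hN, h, hB]
    rw [indicator_of_mem hω, Pi.one_apply, one_mul]
    calc e ^ ((G ω).clusterWithin W A).ncard
        ≤ e ^ (((G ω).clusterWithin (W.erase i) (A.erase i ∪ N)).ncard + 1) := by
          refine pow_le_pow_right₀ he ?_
          refine (ncard_le_ncard ((G ω).clusterWithin_subset_insert W A N i ?_)
            (toFinite _)).trans (ncard_insert_le _ _)
          intro j hjW hjA hj
          simp [hN, hU, hjW, hjA, hj]
      _ ≤ e * f N ω := by
          rw [pow_succ']
          gcongr
          exact hf_le N hNU ω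
  · have hterm : ∀ N ∈ U.powerset, ∫⁻ ω, (D N).indicator 1 ω * (e * f N ω) ∂μ
        ≤ (e * ∏ j ∈ A.erase i, φ j) * (μ (D N) * ∏ j ∈ N, φ j) := by
      intro N hN
      rw [lintegral_mul_eq_lintegral_mul_lintegral_of_independent_measurableSpace (hTle _)
        (hTle _) hind (hind_meas le_rfl N) ((hf_meas N hN).const_mul e),
        lintegral_indicator_one (hTle _ _ (hDm N)),
        lintegral_const_mul _ ((hf_meas N hN).mono (hTle _) le_rfl)]
      have hdis : Disjoint (A.erase i) N := by
        rw [Finset.disjoint_left]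
        have := Finset.mem_powerset.1 hN
        grind
      calc μ (D N) * (e * ∫⁻ ω, f N ω ∂μ) ≤ μ (D N) * (e * ∏ j ∈ A.erase i ∪ N, φ j) := by
            gcongr
            exact hf_int N hN
        _ = _ := by
            rw [Finset.prod_union hdis]
            ring
    rw [lintegral_finsetSum']
    · calc ∑ N ∈ U.powerset, ∫⁻ ω, (D N).indicator 1 ω * (e * f N ω) ∂μ
          ≤ ∑ N ∈ U.powerset, (e * ∏ j ∈ A.erase i, φ j) * (μ (D N) * ∏ j ∈ N, φ j) :=
            Finset.sum_le_sum hterm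
        _ = (e * ∏ j ∈ U, (μ (B j) * φ j + μ (B j)ᶜ)) * ∏ j ∈ A.erase i, φ j := by
            rw [← Finset.mul_sum, hBindep.sum_powerset_measure_mul_prod]
            ring
        _ ≤ φ i * ∏ j ∈ A.erase i, φ j := by
            gcongr
            exact hφ i U hiU
        _ = ∏ j ∈ A, φ j := Finset.mul_prod_erase _ _ hi
    · intro N hN
      exact ((hind_meas (hTle _) N).mul
        (((hf_meas N hN).mono (hTle _) le_rfl).const_mul e)).aemeasurable

/-- Markov's inequality for the exponential moment of a cluster. -/
theorem measure_le_ncard_supp_le {V Ω : Type*} [Fintype V] [DecidableEq V]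
    [MeasurableSpace Ω] (μ : Measure Ω) [IsProbabilityMeasure μ] (G : Ω → SimpleGraph V)
    (hmeas : ∀ p : Sym2 V, MeasurableSet {ω | p ∈ (G ω).edgeSet})
    (hindep : iIndepSet (fun p : Sym2 V => {ω | p ∈ (G ω).edgeSet}) μ)
    (l : ℝ) (hl : 0 ≤ l) (φ : V → ENNReal)
    (hφ : ∀ (i : V) (U : Finset V), i ∉ U → ENNReal.ofReal (Real.exp l) *
      ∏ j ∈ U, (μ {ω | (G ω).Adj i j} * φ j + μ {ω | (G ω).Adj i j}ᶜ) ≤ φ i)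
    (v : V) (K : ℝ) :
    μ {ω | K ≤ (((G ω).connectedComponentMk v).supp.ncard : ℝ)}
      ≤ φ v * ENNReal.ofReal (Real.exp (-(l * K))) := by
  obtain ⟨f, hfm, hf, hfi⟩ := exists_clusterWithin_pow_le μ G hmeas hindep _
    (by simpa using hl) φ hφ Finset.univ {v} (Finset.subset_univ _)
  replace hfm : Measurable f := hfm.mono (iSup₂_le fun p _ =>
    MeasurableSpace.generateFrom_le (by rintro _ rfl; exact hmeas p)) le_rfl
  have hpos : ENNReal.ofReal (Real.exp (l * K)) ≠ 0 := by simp [Real.exp_pos]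
  calc μ {ω | K ≤ (((G ω).connectedComponentMk v).supp.ncard : ℝ)}
      ≤ μ {ω | ENNReal.ofReal (Real.exp (l * K)) ≤ f ω} := by
        refine measure_mono fun ω hω => le_trans ?_ (hf ω)
        rw [mem_ofPred_eq, SimpleGraph.supp_connectedComponentMk_eq_clusterWithin] at hω
        rw [← ENNReal.ofReal_pow (Real.exp_pos _).le, ← Real.exp_nat_mul]
        refine ENNReal.ofReal_le_ofReal (Real.exp_le_exp.2 ?_)
        rw [mul_comm]
        gcongr
    _ ≤ (∫⁻ ω, f ω ∂μ) / ENNReal.ofReal (Real.exp (l * K)) :=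
        meas_ge_le_lintegral_div hfm.aemeasurable hpos ENNReal.ofReal_ne_top
    _ ≤ φ v * ENNReal.ofReal (Real.exp (-(l * K))) := by
        rw [div_eq_mul_inv, Real.exp_neg, ENNReal.ofReal_inv_of_pos (Real.exp_pos _)]
        gcongr
        simpa using hfi

theorem Real.exp_sub_one_le_mul_exp (x : ℝ) : Real.exp x - 1 ≤ x * Real.exp x := by
  have h := Real.add_one_le_exp (-x)
  have h2 : Real.exp (-x) * Real.exp x = 1 := by rw [← Real.exp_add]; simp
  nlinarith [Real.exp_pos x]

theorem Real.sum_range_succ_rpow_le {s : ℝ} (hs0 : 0 < s) (hs1 : s ≤ 1) (n : ℕ) :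
    ∑ j ∈ Finset.range n, ((j : ℝ) + 1) ^ (s - 1) ≤ (n : ℝ) ^ s / s := by
  induction n with
  | zero => simp [Real.zero_rpow hs0.ne']
  | succ n ih =>
    rw [Finset.sum_range_succ]
    have hn : (0 : ℝ) < (n : ℝ) + 1 := by positivity
    have hb : (1 + -(1 / ((n : ℝ) + 1))) ^ s ≤ 1 + s * -(1 / ((n : ℝ) + 1)) :=
      rpow_one_add_le_one_add_mul_self (neg_le_neg (by rw [div_le_one hn]; simp)) hs0.le hs1
    have h1 : (n : ℝ) ^ s = ((n : ℝ) + 1) ^ s * (1 + -(1 / ((n : ℝ) + 1))) ^ s := by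
      rw [← Real.mul_rpow hn.le]
      · congr 1
        field_simp
        ring
      · have : 1 / ((n : ℝ) + 1) ≤ 1 := by rw [div_le_one hn]; simp
        linarith
    have h2 : ((n : ℝ) + 1) ^ (s - 1) = ((n : ℝ) + 1) ^ s / ((n : ℝ) + 1) := by
      rw [Real.rpow_sub hn, Real.rpow_one]
    have h3 : (n : ℝ) ^ s ≤ ((n : ℝ) + 1) ^ s - s * ((n : ℝ) + 1) ^ (s - 1) := by
      rw [h1, h2]
      calc _ ≤ ((n : ℝ) + 1) ^ s * (1 + s * -(1 / ((n : ℝ) + 1))) := by gcongr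
        _ = _ := by ring
    have h4 : (n : ℝ) ^ s / s ≤ ((n : ℝ) + 1) ^ s / s - ((n : ℝ) + 1) ^ (s - 1) := by
      rw [div_le_iff₀ hs0, sub_mul, div_mul_cancel₀ _ hs0.ne']
      linarith
    push_cast
    linarith

/-- The weight `ψ((j+1)/n)` of the `j`-th vertex, with exponent `a = 1/(γ-1)`. -/
noncomputable def chungLuWeight (a : ℝ) (n : ℕ) (j : ℕ) : ℝ := (((j : ℝ) + 1) / n) ^ (-a)

theorem chungLuWeight_eq {a : ℝ} (n j : ℕ) :
    chungLuWeight a n j = (n : ℝ) ^ a * ((j : ℝ) + 1) ^ (-a) := by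
  rw [chungLuWeight, Real.div_rpow (by positivity) (by positivity),
    Real.rpow_neg (Nat.cast_nonneg n), div_inv_eq_mul, mul_comm]

theorem one_le_chungLuWeight {a : ℝ} (ha : 0 ≤ a) {n j : ℕ} (hj : j < n) :
    1 ≤ chungLuWeight a n j := by
  have hn : (0 : ℝ) < n := by exact_mod_cast (Nat.zero_le j).trans_lt hj
  refine Real.one_le_rpow_of_pos_of_le_one_of_nonpos (by positivity) ?_ (by linarith)
  rw [div_le_one hn]
  exact_mod_cast hj

theorem chungLuWeight_le {a : ℝ} (ha : 0 ≤ a) (n j : ℕ) :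
    chungLuWeight a n j ≤ (n : ℝ) ^ a := by
  rw [chungLuWeight_eq]
  exact mul_le_of_le_one_right (by positivity)
    (Real.rpow_le_one_of_one_le_of_nonpos (by simp) (by linarith))

theorem sum_chungLuWeight_sq_le {a : ℝ} (ha0 : 0 < a) (ha : a < 1 / 2) {n : ℕ} (hn : 0 < n) :
    ∑ j ∈ Finset.range n, chungLuWeight a n j ^ 2 ≤ n / (1 - 2 * a) := by
  have hn' : (0 : ℝ) < n := by exact_mod_cast hn
  have h : ∀ j : ℕ, chungLuWeight a n j ^ 2
      = (n : ℝ) ^ (2 * a) * ((j : ℝ) + 1) ^ ((1 - 2 * a) - 1) := by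
    intro j
    rw [chungLuWeight_eq, mul_pow, ← Real.rpow_natCast, ← Real.rpow_natCast,
      ← Real.rpow_mul (by positivity), ← Real.rpow_mul (by positivity)]
    push_cast
    ring_nf
  simp_rw [h]
  rw [← Finset.mul_sum]
  calc _ ≤ (n : ℝ) ^ (2 * a) * ((n : ℝ) ^ (1 - 2 * a) / (1 - 2 * a)) := by
        gcongr
        exact Real.sum_range_succ_rpow_le (by linarith) (by linarith) n
    _ = n / (1 - 2 * a) := by
        rw [mul_div_assoc', ← Real.rpow_add hn']
        simp

theorem card_filter_succ_lt_le {n : ℕ} {x : ℝ} (hx : 0 ≤ x) :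
    (((Finset.range n).filter fun j : ℕ => (j : ℝ) + 1 < x).card : ℝ) ≤ x := by
  have h : ((Finset.range n).filter fun j : ℕ => (j : ℝ) + 1 < x) ⊆ Finset.range ⌊x⌋₊ := by
    intro j hj
    rw [Finset.mem_range]
    refine Nat.lt_of_succ_le (Nat.le_floor ?_)
    push_cast
    exact (Finset.mem_filter.1 hj).2.le
  calc _ ≤ ((Finset.range ⌊x⌋₊).card : ℝ) := by exact_mod_cast Finset.card_le_card h
    _ ≤ x := by simpa using Nat.floor_le hx

/-- Exponentially tilted second moment of the weights, at tilt `b log n / n ^ a`. -/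
theorem sum_chungLuWeight_sq_mul_exp_le {a b ε : ℝ} (ha0 : 0 < a) (ha : a < 1 / 2) (hb : 0 < b)
    {n : ℕ} (hn : 0 < n) :
    (∑ j ∈ Finset.range n, chungLuWeight a n j ^ 2 *
        Real.exp (b * Real.log n / (n : ℝ) ^ a * chungLuWeight a n j)) / n ≤
      Real.exp (b * (Real.log n * (n : ℝ) ^ (-(ε * a)))) / (1 - 2 * a)
        + (n : ℝ) ^ (2 * a + b + ε - 1) := by
  have hn' : (0 : ℝ) < n := by exact_mod_cast hn
  have hlog : 0 ≤ Real.log n := Real.log_natCast_nonneg n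
  have hna : (0 : ℝ) < (n : ℝ) ^ a := by positivity
  have htw : ∀ j : ℕ, b * Real.log n / (n : ℝ) ^ a * chungLuWeight a n j
      = b * Real.log n * ((j : ℝ) + 1) ^ (-a) := by
    intro j
    rw [chungLuWeight_eq]
    field_simp
  set E := Real.exp (b * (Real.log n * (n : ℝ) ^ (-(ε * a)))) with hE
  have hterm : ∀ j ∈ Finset.range n, chungLuWeight a n j ^ 2 *
      Real.exp (b * Real.log n / (n : ℝ) ^ a * chungLuWeight a n j)
      ≤ E * chungLuWeight a n j ^ 2
        + if (j : ℝ) + 1 < (n : ℝ) ^ ε then (n : ℝ) ^ (2 * a + b) else 0 := by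
    intro j hj
    rw [htw]
    have hwpos : 0 ≤ chungLuWeight a n j := by rw [chungLuWeight]; positivity
    split_ifs with h
    · have h1 : chungLuWeight a n j ^ 2 ≤ (n : ℝ) ^ (2 * a) := by
        rw [mul_comm, Real.rpow_mul hn'.le, Real.rpow_two]
        gcongr
        exact chungLuWeight_le ha0.le n j
      have h2 : Real.exp (b * Real.log n * ((j : ℝ) + 1) ^ (-a)) ≤ (n : ℝ) ^ b := by
        rw [Real.rpow_def_of_pos hn']
        refine Real.exp_le_exp.2 ?_
        rw [mul_comm b]
        exact mul_le_of_le_one_right (by positivity)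
          (Real.rpow_le_one_of_one_le_of_nonpos (by simp) (by linarith))
      rw [Real.rpow_add hn']
      have h3 : 0 ≤ E * chungLuWeight a n j ^ 2 := by positivity
      have h4 := mul_le_mul h1 h2 (Real.exp_pos _).le (by positivity)
      linarith
    · rw [add_zero, mul_comm (chungLuWeight a n j ^ 2)]
      refine mul_le_mul_of_nonneg_right (Real.exp_le_exp.2 ?_) (by positivity)
      rw [mul_assoc]
      gcongr
      rw [neg_mul_eq_mul_neg, Real.rpow_mul hn'.le]
      exact Real.rpow_le_rpow_of_nonpos (by positivity) (not_lt.1 h) (by linarith)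
  have hsum := Finset.sum_le_sum hterm
  rw [Finset.sum_add_distrib, ← Finset.mul_sum, ← Finset.sum_filter, Finset.sum_const,
    nsmul_eq_mul] at hsum
  have hcard := card_filter_succ_lt_le (n := n) (x := (n : ℝ) ^ ε) (by positivity)
  calc _ ≤ (E * (n / (1 - 2 * a)) + (n : ℝ) ^ ε * (n : ℝ) ^ (2 * a + b)) / n := by
        gcongr
        refine hsum.trans ?_
        gcongr
        exact sum_chungLuWeight_sq_le ha0 ha hn
    _ = _ := by
        rw [show 2 * a + b + ε - 1 = ε + (2 * a + b) - 1 by ring, Real.rpow_sub hn',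
          Real.rpow_add hn' ε, Real.rpow_one]
        field_simp

theorem eventually_tilted_chungLuWeight_le {a b θ r : ℝ} (ha0 : 0 < a) (ha : a < 1 / 2)
    (hb : 0 < b) (hb' : 2 * a + b < 1) (hθ : 0 < θ) (hr : θ / (1 - 2 * a) < r) :
    ∀ᶠ n : ℕ in atTop, θ * ((∑ j ∈ Finset.range n, chungLuWeight a n j ^ 2 *
        Real.exp (b * Real.log n / (n : ℝ) ^ a * chungLuWeight a n j)) / n) ≤ r := by
  set ε := (1 - (2 * a + b)) / 2 with hε
  have hε0 : 0 < ε := by rw [hε]; linarith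
  have h1 : Tendsto (fun x : ℝ => Real.log x * x ^ (-(ε * a))) atTop (nhds 0) := by
    refine ((isLittleO_log_rpow_atTop (mul_pos hε0 ha0)).tendsto_div_nhds_zero).congr' ?_
    filter_upwards [eventually_ge_atTop 0] with x hx
    rw [Real.rpow_neg hx, div_eq_mul_inv]
  have h2 : Tendsto (fun x : ℝ => x ^ (2 * a + b + ε - 1)) atTop (nhds 0) := by
    have := tendsto_rpow_neg_atTop hε0
    convert this using 3
    rw [hε]; ring
  have h3 : Tendsto (fun x : ℝ => θ * (Real.exp (b * (Real.log x * x ^ (-(ε * a)))) / (1 - 2 * a)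
      + x ^ (2 * a + b + ε - 1))) atTop (nhds (θ * (Real.exp (b * 0) / (1 - 2 * a) + 0))) :=
    ((((Real.continuous_exp.tendsto _).comp (h1.const_mul b)).div_const _).add h2).const_mul θ
  have h4 := (h3.comp tendsto_natCast_atTop_atTop).eventually_lt_const
    (u := r) (by simpa [div_eq_mul_inv] using hr)
  filter_upwards [h4, eventually_gt_atTop 0] with n hn hn0
  exact (mul_le_mul_of_nonneg_left (sum_chungLuWeight_sq_mul_exp_le ha0 ha hb hn0) hθ.le).trans
    hn.le

/-- `φ j = exp (t w_j)` is a supersolution of the branching recursion once the tilted second moment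
of the weights is at most `r / θ` with `r ≤ 1`. -/
theorem exp_mul_prod_le_exp {n : ℕ} {θ t r : ℝ} (hθ : 0 < θ) (ht : 0 ≤ t) (hr : r ≤ 1)
    {w : Fin n → ℝ} (hw : ∀ i, 1 ≤ w i)
    (hS : θ * ((∑ j, w j ^ 2 * Real.exp (t * w j)) / n) ≤ r)
    (i : Fin n) (U : Finset (Fin n)) (p : Fin n → ℝ)
    (hp0 : ∀ j ∈ U, 0 ≤ p j) (hp : ∀ j ∈ U, p j ≤ θ * w i * w j / n) :
    Real.exp ((1 - r) * t) * ∏ j ∈ U, (p j * Real.exp (t * w j) + (1 - p j))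
      ≤ Real.exp (t * w i) := by
  have hwi := hw i
  have hw0 : ∀ j, 0 ≤ w j := fun j => zero_le_one.trans (hw j)
  have hx : ∀ j, 0 ≤ Real.exp (t * w j) - 1 := fun j => by
    have := Real.one_le_exp (mul_nonneg ht (hw0 j))
    linarith
  have hprod : ∏ j ∈ U, (p j * Real.exp (t * w j) + (1 - p j))
      ≤ Real.exp (∑ j ∈ U, θ * w i * w j / n * (t * w j * Real.exp (t * w j))) := by
    rw [Real.exp_sum]
    refine Finset.prod_le_prod (fun j hj => ?_) fun j hj => ?_
    · have := mul_nonneg (hp0 j hj) (hx j)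
      linarith
    · calc p j * Real.exp (t * w j) + (1 - p j) = p j * (Real.exp (t * w j) - 1) + 1 := by ring
        _ ≤ Real.exp (p j * (Real.exp (t * w j) - 1)) := Real.add_one_le_exp _
        _ ≤ _ := by
          refine Real.exp_le_exp.2 (mul_le_mul (hp j hj) (Real.exp_sub_one_le_mul_exp _) (hx j) ?_)
          exact (hp0 j hj).trans (hp j hj)
  have hsum : ∑ j ∈ U, θ * w i * w j / n * (t * w j * Real.exp (t * w j)) ≤ r * (t * w i) := by
    calc _ ≤ ∑ j, θ * w i * w j / n * (t * w j * Real.exp (t * w j)) := by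
          refine Finset.sum_le_sum_of_subset_of_nonneg (Finset.subset_univ _) fun j _ _ => ?_
          have := hw0 j
          have := hw0 i
          positivity
      _ = θ * ((∑ j, w j ^ 2 * Real.exp (t * w j)) / n) * (t * w i) := by
          rw [Finset.sum_div, Finset.mul_sum, Finset.sum_mul]
          exact Finset.sum_congr rfl fun j _ => by ring
      _ ≤ _ := mul_le_mul_of_nonneg_right hS (mul_nonneg ht (hw0 i))
  calc _ ≤ Real.exp ((1 - r) * t) * Real.exp (r * (t * w i)) := by
        gcongr
        exact hprod.trans (Real.exp_le_exp.2 hsum)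
    _ ≤ _ := by
        rw [← Real.exp_add]
        refine Real.exp_le_exp.2 ?_
        nlinarith [mul_nonneg (mul_nonneg (sub_nonneg.2 hr) ht) (sub_nonneg.2 hwi)]

/-- At tilt `b log n / n ^ a`, the largest cluster exceeds a large multiple of `n ^ a` with
probability at most `1 / n`. -/
theorem measure_exists_chungLu_cluster_ge_le {a b θ r : ℝ} (ha0 : 0 < a) (hb : 0 < b) (hθ : 0 < θ)
    (hr : r < 1) {n : ℕ} (hn : 0 < n)
    (hS : θ * ((∑ j ∈ Finset.range n, chungLuWeight a n j ^ 2 *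
        Real.exp (b * Real.log n / (n : ℝ) ^ a * chungLuWeight a n j)) / n) ≤ r)
    {Ω : Type*} [MeasurableSpace Ω] (μ : Measure Ω) [IsProbabilityMeasure μ]
    (G : Ω → SimpleGraph (Fin n))
    (hmeas : ∀ p : Sym2 (Fin n), MeasurableSet {ω | p ∈ (G ω).edgeSet})
    (hindep : iIndepSet (fun p : Sym2 (Fin n) => {ω | p ∈ (G ω).edgeSet}) μ)
    (hedge : ∀ i j : Fin n, i ≠ j → μ {ω | (G ω).Adj i j} =
      ENNReal.ofReal (min 1 (θ * chungLuWeight a n i * chungLuWeight a n j / n))) :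
    μ {ω | ∃ v : Fin n, (b + 2) / ((1 - r) * b) * (n : ℝ) ^ a
        ≤ (((G ω).connectedComponentMk v).supp.ncard : ℝ)} ≤ ENNReal.ofReal ((n : ℝ)⁻¹) := by
  have hn' : (0 : ℝ) < n := by exact_mod_cast hn
  have hlog : 0 ≤ Real.log n := Real.log_natCast_nonneg n
  have hna : (0 : ℝ) < (n : ℝ) ^ a := by positivity
  set t := b * Real.log n / (n : ℝ) ^ a with ht
  have ht0 : 0 ≤ t := by positivity
  set w : Fin n → ℝ := fun j => chungLuWeight a n j with hw
  have hw1 : ∀ j, 1 ≤ w j := fun j => one_le_chungLuWeight ha0.le j.2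
  have hw0 : ∀ j, 0 < w j := fun j => zero_lt_one.trans_le (hw1 j)
  set q : Fin n → Fin n → ℝ := fun i j => min 1 (θ * w i * w j / n) with hq
  have hq0 : ∀ i j, 0 ≤ q i j := fun i j => by
    have := hw0 i
    have := hw0 j
    exact le_min zero_le_one (by positivity)
  rw [Finset.sum_range] at hS
  have hφ : ∀ (i : Fin n) (U : Finset (Fin n)), i ∉ U →
      ENNReal.ofReal (Real.exp ((1 - r) * t)) *
        ∏ j ∈ U, (μ {ω | (G ω).Adj i j} * ENNReal.ofReal (Real.exp (t * w j))
          + μ {ω | (G ω).Adj i j}ᶜ) ≤ ENNReal.ofReal (Real.exp (t * w i)) := by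
    intro i U hiU
    have hfac : ∀ j ∈ U, μ {ω | (G ω).Adj i j} * ENNReal.ofReal (Real.exp (t * w j))
          + μ {ω | (G ω).Adj i j}ᶜ
        = ENNReal.ofReal (q i j * Real.exp (t * w j) + (1 - q i j)) := by
      intro j hj
      have hij : i ≠ j := fun h => hiU (h ▸ hj)
      have hq1 : q i j ≤ 1 := min_le_left _ _
      have hm : MeasurableSet {ω | (G ω).Adj i j} := hmeas s(i, j)
      rw [prob_compl_eq_one_sub hm, hedge i j hij,
        ENNReal.ofReal_add (mul_nonneg (hq0 i j) (Real.exp_pos _).le) (by linarith),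
        ENNReal.ofReal_mul (hq0 i j), ENNReal.ofReal_sub _ (hq0 i j), ENNReal.ofReal_one]
    have hnonneg : ∀ j ∈ U, 0 ≤ q i j * Real.exp (t * w j) + (1 - q i j) := fun j _ =>
      add_nonneg (mul_nonneg (hq0 i j) (Real.exp_pos _).le) (sub_nonneg.2 (min_le_left _ _))
    rw [Finset.prod_congr rfl hfac, ← ENNReal.ofReal_prod_of_nonneg hnonneg,
      ← ENNReal.ofReal_mul (Real.exp_pos _).le]
    exact ENNReal.ofReal_le_ofReal (exp_mul_prod_le_exp hθ ht0 hr.le hw1 hS i U (q i)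
      (fun j _ => hq0 i j) fun j _ => min_le_right _ _)
  have hr' : 0 < 1 - r := sub_pos.2 hr
  have hlK : (1 - r) * t * ((b + 2) / ((1 - r) * b) * (n : ℝ) ^ a) = (b + 2) * Real.log n := by
    rw [ht]
    field_simp
  have hone : ∀ v : Fin n, μ {ω | (b + 2) / ((1 - r) * b) * (n : ℝ) ^ a
      ≤ (((G ω).connectedComponentMk v).supp.ncard : ℝ)}
      ≤ ENNReal.ofReal (Real.exp (-(2 * Real.log n))) := by
    intro v
    refine (measure_le_ncard_supp_le μ G hmeas hindep _ (mul_nonneg hr'.le ht0) _ hφ v _).trans ?_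
    rw [← ENNReal.ofReal_mul (Real.exp_pos _).le, ← Real.exp_add, hlK]
    refine ENNReal.ofReal_le_ofReal (Real.exp_le_exp.2 ?_)
    have : t * w v ≤ b * Real.log n := by
      calc t * w v ≤ t * (n : ℝ) ^ a := by
            gcongr
            exact chungLuWeight_le ha0.le n v
        _ = b * Real.log n := div_mul_cancel₀ _ hna.ne'
    linarith
  rw [ofPred_exists]
  refine (measure_iUnion_fintype_le μ _).trans ((Finset.sum_le_sum fun v _ => hone v).trans ?_)
  rw [Finset.sum_const, Finset.card_univ, Fintype.card_fin, nsmul_eq_mul,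
    ← ENNReal.ofReal_natCast, ← ENNReal.ofReal_mul hn'.le]
  refine ENNReal.ofReal_le_ofReal (le_of_eq ?_)
  rw [Real.exp_neg, two_mul, Real.exp_add, Real.exp_log hn']
  field_simp

/-- Subcritical Chung–Lu graphs, `γ > 3`, `0 < θ < θ_c = (γ-3)/(γ-1)`.
`G n` is the random graph on `{1,…,n}` (encoded as `Fin n`, vertex `i : Fin n`
representing label `i+1`) in which, independently for each pair of distinct
vertices `i, j`, the edge is present with probability
`min 1 (θ ψ((i+1)/n) ψ((j+1)/n) / n)` where `ψ(x) = x^(-1/(γ-1))`.  Then there is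
a constant `C` (depending only on `γ` and `θ`) with
`P(max_v |𝒞_v| ≥ C n^(1/(γ-1))) → 0`. -/
theorem chungLu_subcritical_max_cluster (γ θ : ℝ) (hγ : 3 < γ)
    (hθ0 : 0 < θ) (hθ : θ < (γ - 3) / (γ - 1))
    (Ω : ℕ → Type) [∀ n, MeasurableSpace (Ω n)]
    (μ : ∀ n, Measure (Ω n)) [∀ n, IsProbabilityMeasure (μ n)]
    (G : ∀ n, Ω n → SimpleGraph (Fin n))
    (hmeas : ∀ n (p : Sym2 (Fin n)), MeasurableSet {ω | p ∈ (G n ω).edgeSet})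
    (hindep : ∀ n,
      iIndepSet (fun p : Sym2 (Fin n) => {ω | p ∈ (G n ω).edgeSet}) (μ n))
    (hedge : ∀ n, ∀ i j : Fin n, i ≠ j →
      μ n {ω | (G n ω).Adj i j} =
        ENNReal.ofReal (min 1
          (θ * (((i : ℕ) + 1 : ℝ) / n) ^ (-(1 / (γ - 1)))
             * (((j : ℕ) + 1 : ℝ) / n) ^ (-(1 / (γ - 1))) / n))) :
    ∃ C : ℝ, Tendsto
      (fun n => μ n {ω | ∃ v : Fin n,
        C * (n : ℝ) ^ ((1:ℝ) / (γ - 1))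
          ≤ (((G n ω).connectedComponentMk v).supp.ncard : ℝ)})
      atTop (nhds 0) := by
  have hγ1 : 0 < γ - 1 := by linarith
  have hγ3 : 0 < γ - 3 := by linarith
  set a : ℝ := 1 / (γ - 1) with ha
  have ha0 : 0 < a := by positivity
  have ha2 : a < 1 / 2 := by
    rw [ha, div_lt_div_iff₀ hγ1 two_pos]
    linarith
  have hcrit : (γ - 3) / (γ - 1) = 1 - 2 * a := by
    rw [ha]
    field_simp
    ring
  rw [hcrit] at hθ
  have hρ : θ / (1 - 2 * a) < 1 := by
    rw [div_lt_one (by linarith)]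
    exact hθ
  obtain ⟨r, hr0, hr1⟩ := exists_between hρ
  set b : ℝ := (1 - 2 * a) / 2 with hb
  have hb0 : 0 < b := by
    rw [hb]
    linarith
  refine ⟨(b + 2) / ((1 - r) * b), ?_⟩
  have hlim : Tendsto (fun n : ℕ => ENNReal.ofReal ((n : ℝ)⁻¹)) atTop (nhds 0) := by
    have h := ENNReal.tendsto_ofReal (tendsto_inv_atTop_nhds_zero_nat (𝕜 := ℝ))
    rwa [ENNReal.ofReal_zero] at h
  refine tendsto_of_tendsto_of_tendsto_of_le_of_le' tendsto_const_nhds hlim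
    (Eventually.of_forall fun _ => zero_le) ?_
  filter_upwards [eventually_tilted_chungLuWeight_le ha0 ha2 hb0
    (by rw [hb]; linarith : 2 * a + b < 1) hθ0 hr0, eventually_gt_atTop 0] with n hS hn
  exact measure_exists_chungLu_cluster_ge_le ha0 hb0 hθ0 hr1 hn hS (μ n) (G n) (hmeas n) (hindep n)
    (hedge n)
end
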